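/- arXiv:math/0002245 — 2 statements merged into one kernel-verified Lean document; each statement's English description precedes it below -/
import Mathlib

section
/- (Garsia–Gessel shuffle theorem) Let (N_1,...,N_r) be a partition of {1,...,n} with |N_i| = n_i, and for each i let π_i be a permutation (linear arrangement) of N_i. Then Σ_{σ ∈ Ω(π_1,...,π_r)} q^{maj(σ)} = [n choose n_1,...,n_r]_q · q^{maj(π_1) + ... + maj(π_r)}, where Ω(π_1,...,π_r) is the set of shuffles of π_1,...,π_r, i.e., permutations σ ∈ S_n in which the letters of each N_i appear in the same relative order as in π_i. -/
open Finset

/-- The major index of a word (list) over `ℕ`: the sum of the 1-indexed positions `i`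
with `a_i > a_{i+1}`. -/
def majL (l : List ℕ) : ℕ :=
  ∑ i ∈ Finset.range l.length,
    if i + 1 < l.length ∧ l.getD (i + 1) 0 < l.getD i 0 then i + 1 else 0

/-- The word `σ(1) σ(2) ⋯ σ(n)` (with letters in `{1,…,n}`) of a permutation. -/
def wordOf {n : ℕ} (σ : Equiv.Perm (Fin n)) : List ℕ :=
  List.ofFn (fun i : Fin n => (σ i : ℕ) + 1)

/-- The `q`-integer `[j]_q`. -/
noncomputable def qInt (j : ℕ) : RatFunc ℚ := ∑ l ∈ Finset.range j, RatFunc.X ^ l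

/-- The `q`-factorial `[n]!_q`. -/
noncomputable def qFact (n : ℕ) : RatFunc ℚ := ∏ j ∈ Finset.range n, qInt (j + 1)

/-- Major index of the reversed word. -/
def mr : List ℕ → ℕ
  | [] => 0
  | [_] => 0
  | a :: b :: l => mr (b :: l) + if a < b then l.length + 1 else 0

/-- The finset of shuffles of two words. -/
def shuf : List ℕ → List ℕ → Finset (List ℕ)
  | [], v => {v}
  | a :: u, [] => {a :: u}
  | a :: u, b :: v =>
      (shuf u (b :: v)).image (List.cons a) ∪ (shuf (a :: u) v).image (List.cons b)
termination_by u v => u.length + v.length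

lemma shuf_nil_right (u : List ℕ) : shuf u [] = {u} := by
  cases u <;> simp [shuf]

lemma shuf_comm (u v : List ℕ) : shuf u v = shuf v u := by
  induction u, v using shuf.induct with
  | case1 v => simp [shuf, shuf_nil_right]
  | case2 a u => simp [shuf]
  | case3 a u b v h1 h2 => rw [shuf, shuf, h1, h2, Finset.union_comm]

lemma mem_shuf (p : ℕ → Bool) (u v l : List ℕ) (hu : ∀ x ∈ u, p x = true)
    (hv : ∀ x ∈ v, p x = false) :
    l ∈ shuf u v ↔ l.filter p = u ∧ l.filter (fun x => !p x) = v := by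
  induction l generalizing u v with
  | nil =>
    cases u <;> cases v <;> simp [shuf]
  | cons c l ih =>
    cases u with
    | nil =>
      simp only [shuf, Finset.mem_singleton]
      constructor
      · rintro rfl
        constructor
        · rw [List.filter_eq_nil_iff]; intro x hx; simp [hv x hx]
        · rw [List.filter_eq_self]; intro x hx; simp [hv x hx]
      · rintro ⟨h1, h2⟩
        rw [List.filter_eq_nil_iff] at h1
        rw [← h2, eq_comm, List.filter_eq_self]
        intro x hx; simpa using h1 x hx
    | cons a u =>
      cases v with
      | nil =>
        simp only [shuf, Finset.mem_singleton]
        constructor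
        · rintro h
          rw [h]
          constructor
          · rw [List.filter_eq_self]; intro x hx; simp [hu x hx]
          · rw [List.filter_eq_nil_iff]; intro x hx; simp [hu x hx]
        · rintro ⟨h1, h2⟩
          rw [List.filter_eq_nil_iff] at h2
          rw [← h1, eq_comm, List.filter_eq_self]
          intro x hx; simpa using h2 x hx
      | cons b v =>
        have e1 := ih u (b :: v) (fun x hx => hu x (by simp [hx])) hv
        have e2 := ih (a :: u) v hu (fun x hx => hv x (by simp [hx]))
        have ha := hu a (by simp)
        have hb := hv b (by simp)
        rw [shuf]
        simp only [Finset.mem_union, Finset.mem_image, List.cons.injEq]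
        constructor
        · rintro (⟨l', h, rfl, rfl⟩ | ⟨l', h, rfl, rfl⟩)
          · have := e1.1 h
            simp [ha, this]
          · have := e2.1 h
            simp [hb, this]
        · rintro ⟨h1, h2⟩
          cases hc : p c with
          | true =>
            simp only [List.filter_cons, hc] at h1 h2
            simp only [if_true, List.cons.injEq] at h1
            exact Or.inl ⟨l, e1.2 ⟨h1.2, by simpa using h2⟩, h1.1.symm, rfl⟩
          | false =>
            simp only [List.filter_cons, hc] at h1 h2
            simp only [Bool.not_false, if_true, List.cons.injEq] at h2
            exact Or.inr ⟨l, e2.2 ⟨by simpa using h1, h2.2⟩, h2.1.symm, rfl⟩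

lemma length_shuf (u v l : List ℕ) (h : l ∈ shuf u v) : l.length = u.length + v.length := by
  induction u, v using shuf.induct generalizing l with
  | case1 v => simp [shuf] at h; simp [h]
  | case2 a u => simp [shuf] at h; simp [h]
  | case3 a u b v h1 h2 =>
    rw [shuf] at h
    simp only [Finset.mem_union, Finset.mem_image] at h
    rcases h with ⟨l', h, rfl⟩ | ⟨l', h, rfl⟩
    · simp [h1 _ h]; omega
    · simp [h2 _ h]; omega

lemma sum_shuf_cons (f : List ℕ → RatFunc ℚ) (a b : ℕ) (u v : List ℕ) (hab : a ≠ b) :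
    ∑ l ∈ shuf (a :: u) (b :: v), f l =
      ∑ l ∈ shuf u (b :: v), f (a :: l) + ∑ l ∈ shuf v (a :: u), f (b :: l) := by
  rw [shuf, Finset.sum_union, Finset.sum_image, Finset.sum_image, shuf_comm v]
  · intro x _ y _ h; simpa using h
  · intro x _ y _ h; simpa using h
  · rw [Finset.disjoint_left]
    intro x hx hy
    simp only [Finset.mem_image] at hx hy
    obtain ⟨l, _, rfl⟩ := hx
    obtain ⟨l', _, h⟩ := hy
    simp only [List.cons.injEq] at h
    exact hab h.1.symm

lemma qInt_ne (j : ℕ) : qInt (j + 1) ≠ 0 := by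
  have h : qInt (j + 1) = algebraMap (Polynomial ℚ) (RatFunc ℚ)
      (∑ l ∈ Finset.range (j + 1), Polynomial.X ^ l) := by
    simp [qInt]
  rw [h]
  intro h0
  rw [map_eq_zero_iff _ (RatFunc.algebraMap_injective ℚ)] at h0
  have := congrArg (Polynomial.eval 1) h0
  simp [Polynomial.eval_finsetSum] at this
  norm_cast at this

lemma qFact_ne (j : ℕ) : qFact j ≠ 0 := by
  rw [qFact, Finset.prod_ne_zero_iff]
  intro i _
  exact qInt_ne i

lemma qFact_succ (j : ℕ) : qFact (j + 1) = qFact j * qInt (j + 1) := by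
  rw [qFact, Finset.prod_range_succ]; rfl

lemma qInt_add (a b : ℕ) : qInt (a + b) = qInt a + RatFunc.X ^ a * qInt b := by
  simp only [qInt, Finset.sum_range_add, Finset.mul_sum, pow_add]

/-- q-binomial coefficient. -/
noncomputable def qb (m k : ℕ) : RatFunc ℚ := qFact (m + k) / (qFact m * qFact k)

lemma qb_comm (m k : ℕ) : qb m k = qb k m := by
  rw [qb, qb, add_comm, mul_comm (qFact m)]

lemma qb_zero (k : ℕ) : qb 0 k = 1 := by
  have := qFact_ne k
  simp [qb, qFact]
  exact this

lemma qb_pascal (m k : ℕ) : qb (m + 1) (k + 1) =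
    qb m (k + 1) + RatFunc.X ^ (m + 1) * qb (m + 1) k := by
  have e : qInt (m + k + 1 + 1) = qInt (m + 1) + RatFunc.X ^ (m + 1) * qInt (k + 1) := by
    rw [← qInt_add]; congr 1; omega
  have h1 := qFact_ne m
  have h2 := qFact_ne k
  have h3 := qInt_ne m
  have h4 := qInt_ne k
  simp only [qb, show m + 1 + (k + 1) = m + k + 1 + 1 by omega,
    show m + (k + 1) = m + k + 1 by omega, show m + 1 + k = m + k + 1 by omega, qFact_succ, e]
  field_simp

lemma qb_pascal' (m k : ℕ) : qb (m + 1) (k + 1) =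
    RatFunc.X ^ (k + 1) * qb m (k + 1) + qb (m + 1) k := by
  rw [qb_comm, qb_pascal, qb_comm k, qb_comm (k+1) m, add_comm]

lemma sum_mr_cons (a c : ℕ) (u v : List ℕ) :
    ∑ l ∈ shuf u v, (RatFunc.X : RatFunc ℚ) ^ mr (a :: c :: l) =
      RatFunc.X ^ (if a < c then u.length + v.length + 1 else 0) *
       ∑ l ∈ shuf u v, (RatFunc.X : RatFunc ℚ) ^ mr (c :: l) := by
  rw [Finset.mul_sum]
  apply Finset.sum_congr rfl
  intro l hl
  rw [mr, length_shuf _ _ _ hl, pow_add, mul_comm]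

lemma refined (s : ℕ) : ∀ (a : ℕ) (u : List ℕ) (b : ℕ) (v : List ℕ), u.length + v.length = s →
    (∀ x ∈ a :: u, ∀ y ∈ b :: v, x ≠ y) →
    ∑ l ∈ shuf u (b :: v), (RatFunc.X : RatFunc ℚ) ^ mr (a :: l) =
      RatFunc.X ^ (if b < a then 0 else v.length + 1) * qb u.length (v.length + 1) *
        RatFunc.X ^ (mr (a :: u) + mr (b :: v)) := by
  induction s with
  | zero =>
    intro a u b v h hd
    have hab : a ≠ b := hd a (by simp) b (by simp)
    obtain rfl : u = [] := List.length_eq_zero_iff.1 (by omega)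
    simp only [shuf, Finset.sum_singleton, List.length_nil, qb_zero, mul_one, ← pow_add, mr]
    congr 1
    split_ifs <;> omega
  | succ s ih =>
    intro a u b v h hd
    have hab : a ≠ b := hd a (by simp) b (by simp)
    cases u with
    | nil =>
      simp only [shuf, Finset.sum_singleton, List.length_nil, qb_zero, mul_one, ← pow_add, mr]
      congr 1
      split_ifs <;> omega
    | cons c u =>
      have hcb : c ≠ b := hd c (by simp) b (by simp)
      simp only [List.length_cons] at h
      rw [sum_shuf_cons _ _ _ _ _ hcb, sum_mr_cons, sum_mr_cons,
        ih c u b v (by omega) (fun x hx y hy => hd x (List.mem_cons_of_mem _ hx) y hy),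
        ih b v c u (by omega)
          (fun x hx y hy => (hd y (List.mem_cons_of_mem _ hy) x hx).symm)]
      rw [qb_comm v.length]
      simp only [List.length_cons, mr]
      have P1 := qb_pascal u.length v.length
      have P2 := qb_pascal' u.length v.length
      generalize qb (u.length + 1) (v.length + 1) = B at *
      generalize qb (u.length + 1) (v.length) = C at *
      generalize qb (u.length) (v.length + 1) = D at *
      generalize mr (c :: u) = M
      generalize mr (b :: v) = M'
      generalize u.length = m at *
      generalize v.length = k at *
      by_cases h1 : a < c <;> by_cases h2 : b < c <;> by_cases h3 : b < a <;>
        first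
        | (exfalso; omega)
        | (have h2' : (c < b) = ¬ (b < c) := by apply propext; omega
           have h3' : (a < b) = ¬ (b < a) := by apply propext; omega
           simp only [h1, h2, h3, h2', h3', if_true, if_false, not_true, not_false_iff]
           first
           | (rw [P1]; ring1)
           | (rw [P2]; ring1))

lemma two_shuffle (u v : List ℕ) (hd : ∀ x ∈ u, ∀ y ∈ v, x ≠ y) :
    ∑ l ∈ shuf u v, (RatFunc.X : RatFunc ℚ) ^ mr l =
      qb u.length v.length * RatFunc.X ^ (mr u + mr v) := by
  cases u with
  | nil => simp [shuf, qb_zero, mr]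
  | cons a u =>
    cases v with
    | nil => simp [shuf, qb_comm _ 0, qb_zero, mr]
    | cons b v =>
      have hab : a ≠ b := hd a (by simp) b (by simp)
      rw [sum_shuf_cons _ _ _ _ _ hab, refined _ a u b v rfl hd,
        refined _ b v a u rfl (fun x hx y hy => (hd y hy x hx).symm), qb_comm v.length]
      simp only [List.length_cons]
      by_cases h : a < b
      · rw [if_pos h, if_neg (by omega), qb_pascal']; ring
      · rw [if_neg h, if_pos (by omega), qb_pascal]; ring

lemma mr_reverse (l : List ℕ) : majL l.reverse = mr l := by
  induction l using mr.induct with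
  | case1 => simp [majL, mr]
  | case2 a => simp [majL, mr]
  | case3 a b l ih =>
    rw [mr, ← ih]
    simp only [majL, List.length_reverse, List.length_cons]
    rw [Finset.sum_range_succ, Finset.sum_range_succ, Finset.sum_range_succ]
    have e1 : (a :: b :: l).reverse = (b :: l).reverse ++ [a] := by simp
    have g1 : ∀ i < l.length + 1, (a :: b :: l).reverse.getD i 0 = (b :: l).reverse.getD i 0 := by
      intro i hi
      rw [e1, List.getD_append]
      simpa using hi
    have g2 : (a :: b :: l).reverse.getD (l.length + 1) 0 = a := by
      rw [e1, List.getD_append_right] <;> simp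
    have g3 : (b :: l).reverse.getD l.length 0 = b := by
      rw [List.reverse_cons, List.getD_append_right] <;> simp
    rw [g2, g1 l.length (by omega), g3]
    have hs : ∀ x ∈ Finset.range l.length,
       (if x + 1 < l.length + 1 + 1 ∧ (a :: b :: l).reverse.getD (x + 1) 0 <
          (a :: b :: l).reverse.getD x 0 then x + 1 else 0) =
       (if x + 1 < l.length + 1 ∧ (b :: l).reverse.getD (x + 1) 0 <
          (b :: l).reverse.getD x 0 then x + 1 else 0) := by
      intro x hx
      rw [Finset.mem_range] at hx
      rw [g1 x (by omega), g1 (x + 1) (by omega)]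
      simp [show x + 1 < l.length + 1 + 1 by omega, show x + 1 < l.length + 1 by omega]
    rw [Finset.sum_congr rfl hs]
    simp

lemma multi {r : ℕ} (N : Fin r → Finset ℕ) (w : Fin r → List ℕ)
    (hdisj : ∀ i j, i ≠ j → Disjoint (N i) (N j)) (hw : ∀ i, ∀ x ∈ w i, x ∈ N i)
    (s : Finset (Fin r)) :
    ∃ S : Finset (List ℕ),
      (∀ l, l ∈ S ↔ (∀ x ∈ l, x ∈ s.biUnion N) ∧
        ∀ i ∈ s, l.filter (fun a => decide (a ∈ N i)) = w i) ∧
      (∀ l ∈ S, l.length = ∑ i ∈ s, (w i).length) ∧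
      ∑ l ∈ S, (RatFunc.X : RatFunc ℚ) ^ mr l =
        (qFact (∑ i ∈ s, (w i).length) / ∏ i ∈ s, qFact (w i).length) *
          RatFunc.X ^ (∑ i ∈ s, mr (w i)) := by
  induction s using Finset.induction_on with
  | empty =>
    refine ⟨{[]}, ?_, ?_, ?_⟩
    · intro l
      simp [List.eq_nil_iff_forall_not_mem]
    · simp
    · simp [mr, qFact]
  | insert j s hj ih =>
    obtain ⟨S, hS, hlen, hsum⟩ := ih
    have hjs : ∀ x ∈ N j, x ∉ s.biUnion N := by
      intro x hx hx'
      obtain ⟨i, hi, hxi⟩ := Finset.mem_biUnion.1 hx'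
      exact Finset.disjoint_left.1 (hdisj j i (by rintro rfl; exact hj hi)) hx hxi
    let p : ℕ → Bool := fun x => decide (x ∈ s.biUnion N)
    have hmem : ∀ τ ∈ S, ∀ l, l ∈ shuf τ (w j) ↔
        l.filter p = τ ∧ l.filter (fun x => !p x) = w j := by
      intro τ hτ l
      apply mem_shuf
      · intro x hx; exact decide_eq_true (((hS τ).1 hτ).1 x hx)
      · intro x hx; exact decide_eq_false (hjs x (hw j x hx))
    refine ⟨S.biUnion (fun τ => shuf τ (w j)), ?_, ?_, ?_⟩
    · intro l
      rw [Finset.mem_biUnion]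
      constructor
      · rintro ⟨τ, hτ, hl⟩
        obtain ⟨h1, h2⟩ := (hmem τ hτ l).1 hl
        have hall : ∀ x ∈ l, x ∉ s.biUnion N → x ∈ N j := by
          intro x hx hn
          apply hw j
          rw [← h2, List.mem_filter]
          exact ⟨hx, by simp only [p, hn]; simp⟩
        constructor
        · intro x hx
          rw [Finset.biUnion_insert, Finset.mem_union]
          by_cases hn : x ∈ s.biUnion N
          · exact Or.inr hn
          · exact Or.inl (hall x hx hn)
        · intro i hi
          rcases Finset.mem_insert.1 hi with rfl | hi
          · rw [← h2]
            apply List.filter_congr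
            intro x hx
            by_cases hn : x ∈ s.biUnion N
            · have : x ∉ N i := fun h => hjs x h hn
              simp only [p, hn, this]; simp
            · simp only [p, hn, hall x hx hn]; simp
          · rw [← ((hS τ).1 hτ).2 i hi, ← h1, List.filter_filter]
            apply List.filter_congr
            intro x hx
            by_cases hn : x ∈ N i
            · have : x ∈ s.biUnion N := Finset.mem_biUnion.2 ⟨i, hi, hn⟩
              simp only [p, hn, this]; simp
            · simp [hn]
      · rintro ⟨h1, h2⟩
        have hτ : l.filter p ∈ S := by
          rw [hS]
          constructor
          · intro x hx
            exact of_decide_eq_true (List.mem_filter.1 hx).2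
          · intro i hi
            rw [← h2 i (Finset.mem_insert_of_mem hi), List.filter_filter]
            apply List.filter_congr
            intro x hx
            by_cases hn : x ∈ N i
            · have : x ∈ s.biUnion N := Finset.mem_biUnion.2 ⟨i, hi, hn⟩
              simp only [p, hn, this]; simp
            · simp [hn]
        refine ⟨_, hτ, (hmem _ hτ l).2 ⟨rfl, ?_⟩⟩
        rw [← h2 j (Finset.mem_insert_self _ _)]
        apply List.filter_congr
        intro x hx
        have := h1 x hx
        rw [Finset.biUnion_insert, Finset.mem_union] at this
        by_cases hn : x ∈ s.biUnion N
        · have : x ∉ N j := fun h => hjs x h hn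
          simp only [p, hn, this]; simp
        · have : x ∈ N j := by tauto
          simp only [p, hn, this]; simp
    · intro l hl
      obtain ⟨τ, hτ, hl⟩ := Finset.mem_biUnion.1 hl
      rw [length_shuf _ _ _ hl, hlen τ hτ, Finset.sum_insert hj, add_comm]
    · rw [Finset.sum_biUnion]
      · have : ∀ τ ∈ S, ∑ l ∈ shuf τ (w j), (RatFunc.X : RatFunc ℚ) ^ mr l =
            RatFunc.X ^ mr τ * (qb (∑ i ∈ s, (w i).length) (w j).length *
              RatFunc.X ^ mr (w j)) := by
          intro τ hτ
          rw [two_shuffle, hlen τ hτ, pow_add]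
          · ring
          · rintro x hx y hy rfl
            exact hjs x (hw j x hy) (((hS τ).1 hτ).1 x hx)
        rw [Finset.sum_congr rfl this, ← Finset.sum_mul, hsum, Finset.sum_insert hj,
          Finset.sum_insert hj, Finset.prod_insert hj, qb, pow_add,
          add_comm (w j).length]
        have h1 := qFact_ne (∑ i ∈ s, (w i).length)
        have h2 := qFact_ne (w j).length
        have h3 : ∏ i ∈ s, qFact (w i).length ≠ 0 :=
          Finset.prod_ne_zero_iff.2 fun i _ => qFact_ne _
        field_simp
      · intro τ hτ τ' hτ' hne
        rw [Function.onFun, Finset.disjoint_left]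
        intro l hl hl'
        exact hne (((hmem τ hτ l).1 hl).1.symm.trans ((hmem τ' hτ' l).1 hl').1)

lemma wordOf_injective {n : ℕ} : Function.Injective (wordOf (n := n)) := by
  intro σ τ h
  have := List.ofFn_injective h
  ext i
  have := congrFun this i
  simpa using this

/-- Garsia–Gessel shuffle theorem: if `(N_1,…,N_r)` is a set
partition of `{1,…,n}` with `|N_i| = n_i` and `π_i` (given as a word `w i`) is a
linear arrangement of `N_i`, then summing `q^{maj(σ)}` over all shuffles `σ` of the
`π_i` (permutations of `{1,…,n}` whose restriction to the letters of `N_i` is `w i`)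
gives the `q`-multinomial `[n; n_1,…,n_r]_q` times `q^{maj(π_1) + ⋯ + maj(π_r)}`. -/
theorem garsia_gessel_shuffle (n r : ℕ) (N : Fin r → Finset ℕ) (nn : Fin r → ℕ)
    (w : Fin r → List ℕ)
    (hcard : ∀ i, (N i).card = nn i)
    (hdisj : ∀ i j, i ≠ j → Disjoint (N i) (N j))
    (hcover : Finset.univ.biUnion N = Finset.Icc 1 n)
    (hword : ∀ i, (w i).Nodup ∧ (w i).toFinset = N i) :
    ∑ σ ∈ Finset.univ.filter
        (fun σ : Equiv.Perm (Fin n) =>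
          ∀ i, (wordOf σ).filter (fun a => decide (a ∈ N i)) = w i),
      (RatFunc.X : RatFunc ℚ) ^ majL (wordOf σ) =
    (qFact n / ∏ i : Fin r, qFact (nn i)) * RatFunc.X ^ (∑ i : Fin r, majL (w i)) := by
  have hw : ∀ i, ∀ x ∈ (w i).reverse, x ∈ N i := by
    intro i x hx
    rw [← (hword i).2]
    simpa using hx
  have hlw : ∀ i, (w i).length = nn i := by
    intro i
    rw [← hcard i, ← (hword i).2, List.toFinset_card_of_nodup (hword i).1]
  have hn : ∑ i, nn i = n := by
    have h := congrArg Finset.card hcover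
    rw [Finset.card_biUnion (fun i _ j _ h => hdisj i j h)] at h
    simpa [hcard] using h
  obtain ⟨S, hS, hlen, hsum⟩ := multi N (fun i => (w i).reverse) hdisj hw Finset.univ
  simp only [List.length_reverse, hlw, hn] at hlen hsum
  have hm : ∀ i, mr (w i).reverse = majL (w i) := by
    intro i; rw [← mr_reverse, List.reverse_reverse]
  simp only [hm] at hsum
  rw [← hsum]
  refine Finset.sum_bij (fun σ _ => (wordOf σ).reverse) ?_ ?_ ?_ ?_
  · intro σ hσ
    rw [Finset.mem_filter] at hσ
    rw [hS]
    constructor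
    · intro x hx
      rw [hcover, Finset.mem_Icc]
      rw [List.mem_reverse, wordOf, List.mem_ofFn] at hx
      obtain ⟨i, rfl⟩ := hx
      have := (σ i).isLt
      omega
    · intro i _
      rw [List.filter_reverse, hσ.2 i]
  · intro σ _ τ _ h
    exact wordOf_injective (List.reverse_injective h)
  · intro l hl
    obtain ⟨h1, h2⟩ := (hS l).1 hl
    have hL := hlen l hl
    have hmem : ∀ x ∈ l.reverse, 1 ≤ x ∧ x ≤ n := by
      intro x hx
      have := h1 x (List.mem_reverse.1 hx)
      rw [hcover, Finset.mem_Icc] at this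
      exact this
    have hnd : l.reverse.Nodup := by
      rw [List.nodup_reverse, List.nodup_iff_count_le_one]
      intro x
      by_cases hx : x ∈ l
      · obtain ⟨i, _, hi⟩ := Finset.mem_biUnion.1 (h1 x hx)
        rw [← List.count_filter (p := fun a => decide (a ∈ N i)) (decide_eq_true hi),
          h2 i (Finset.mem_univ i)]
        exact List.nodup_iff_count_le_one.1 (List.nodup_reverse.2 (hword i).1) x
      · rw [List.count_eq_zero_of_not_mem hx]; omega
    have hLr : l.reverse.length = n := by simpa using hL
    let f : Fin n → Fin n := fun i => ⟨l.reverse[(i : ℕ)]'(by rw [hLr]; exact i.2) - 1, by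
      have := hmem _ (List.getElem_mem (l := l.reverse) (n := i) (by rw [hLr]; exact i.2))
      omega⟩
    have hf : Function.Injective f := by
      intro i j hij
      have e := congrArg Fin.val hij
      simp only [f] at e
      have a1 := hmem _ (List.getElem_mem (l := l.reverse) (n := i) (by rw [hLr]; exact i.2))
      have a2 := hmem _ (List.getElem_mem (l := l.reverse) (n := j) (by rw [hLr]; exact j.2))
      exact Fin.ext ((hnd.getElem_inj_iff).1 (by omega))
    have hwd : wordOf (Equiv.ofBijective f (Finite.injective_iff_bijective.1 hf)) =
        l.reverse := by
      apply List.ext_getElem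
      · simp [wordOf, hL]
      · intro i hi1 hi2
        have a1 := hmem _ (List.getElem_mem (l := l.reverse) (n := i) hi2)
        simp only [wordOf, List.getElem_ofFn, Equiv.ofBijective_apply, f]
        omega
    refine ⟨_, ?_, by rw [hwd, List.reverse_reverse]⟩
    rw [Finset.mem_filter]
    refine ⟨Finset.mem_univ _, fun i => ?_⟩
    rw [hwd, List.filter_reverse, h2 i (Finset.mem_univ i), List.reverse_reverse]
  · intro σ _
    rw [← mr_reverse, List.reverse_reverse]
end

section
/- (Garsia–Gessel, t-partite partitions) Let B_{t,n} be the set of t-tuples f = (f_1,...,f_t) of functions f_i : {1,...,n} → ℕ such that whenever f_i(j) = f_i(j+1) for all i < i_0 one has f_{i_0}(j) ≥ f_{i_0}(j+1). Then Σ_{f ∈ B_{t,n}} q_1^{|f_1|} ⋯ q_t^{|f_t|} = [Σ_{π_1 ⋯ π_t = 1 in S_n} Π_{i=1}^t q_i^{maj(π_i)}] / [Π_{i=1}^t Π_{j=1}^n (1 - q_i^j)], as an identity of formal power series in q_1,...,q_t. -/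
open Finset

/-- The major index of `π ∈ S_n`. -/
def majP {n : ℕ} (π : Equiv.Perm (Fin n)) : ℕ :=
  ∑ i ∈ Finset.range n, if h : i + 1 < n then
    (if π ⟨i + 1, h⟩ < π ⟨i, by omega⟩ then i + 1 else 0) else 0

/-- `f = (f_1,…,f_t)` is a `t`-partite partition with `n` parts: whenever
`f_i(j) = f_i(j+1)` for all `i < i_0`, one has `f_{i_0}(j) ≥ f_{i_0}(j+1)`. -/
def PartiteCond (t n : ℕ) (f : Fin t → Fin n → ℕ) : Prop :=
  ∀ (i0 : Fin t) (j : ℕ) (hj : j + 1 < n),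
    (∀ i : Fin t, i < i0 → f i ⟨j, by omega⟩ = f i ⟨j + 1, hj⟩) →
    f i0 ⟨j + 1, hj⟩ ≤ f i0 ⟨j, by omega⟩

/-- The generating function `Σ_{f ∈ B_{t,n}} q_1^{|f_1|} ⋯ q_t^{|f_t|}` of
`t`-partite partitions with `n` parts, as a formal power series: the coefficient of
`q_1^{d_1} ⋯ q_t^{d_t}` is the number of `f ∈ B_{t,n}` with `|f_i| = d_i` for all `i`. -/
noncomputable def partiteSeries (t n : ℕ) : MvPowerSeries (Fin t) ℚ :=
  fun d => (Nat.card {f : Fin t → Fin n → ℕ //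
    PartiteCond t n f ∧ ∀ i : Fin t, ∑ j : Fin n, f i j = d i} : ℚ)

/-- weak lexicographic comparison, first coordinate most significant -/
def RL {t : ℕ} (a b : Fin t → ℕ) : Prop :=
  ∀ i0 : Fin t, (∀ i, i < i0 → a i = b i) → b i0 ≤ a i0

/-- weak lexicographic comparison, last coordinate most significant -/
def RR {t : ℕ} (a b : Fin t → ℕ) : Prop :=
  ∀ i0 : Fin t, (∀ i, i0 < i → a i = b i) → b i0 ≤ a i0

theorem RL_total {t : ℕ} (a b : Fin t → ℕ) : RL a b ∨ RL b a := by
  by_contra! h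
  obtain ⟨h1, h2⟩ := h
  apply h2
  unfold RL at h1
  push Not at h1
  obtain ⟨i0, he, hlt⟩ := h1
  intro i1 h1
  rcases lt_trichotomy i1 i0 with h | h | h
  · exact (he _ h).le
  · subst h; exact hlt.le
  · have := h1 _ h; omega

theorem RL_antisymm {t : ℕ} (a b : Fin t → ℕ) (h1 : RL a b) (h2 : RL b a) : a = b := by
  funext i
  induction i using WellFoundedLT.induction with
  | ind i ih => exact le_antisymm (h2 i fun j hj => (ih j hj).symm) (h1 i ih)

theorem RL_trans {t : ℕ} (a b c : Fin t → ℕ) (h1 : RL a b) (h2 : RL b c) : RL a c := by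
  intro i0 h
  have key : ∀ i, i < i0 → a i = b i := by
    intro i
    induction i using WellFoundedLT.induction with
    | ind i ih =>
      intro hi
      have e1 := h1 i fun j hj => ih j hj (hj.trans hi)
      have e2 := h2 i fun j hj => (ih j hj (hj.trans hi)).symm.trans (h j (hj.trans hi))
      have := h i hi
      omega
  exact (h2 i0 fun j hj => (key j hj).symm.trans (h j hj)).trans (h1 i0 key)

theorem RR_iff {t : ℕ} (a b : Fin t → ℕ) : RR a b ↔ RL (a ∘ Fin.rev) (b ∘ Fin.rev) := by
  constructor
  · intro h i0 hi
    refine h _ fun i h' => ?_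
    have := hi (Fin.rev i) (by rwa [← Fin.rev_lt_rev, Fin.rev_rev])
    simpa using this
  · intro h i0 hi
    have := h (Fin.rev i0) fun i h' => hi _ (by rwa [← Fin.rev_lt_rev, Fin.rev_rev])
    simpa using this

theorem RR_total {t : ℕ} (a b : Fin t → ℕ) : RR a b ∨ RR b a := by
  rw [RR_iff, RR_iff]; exact RL_total _ _

theorem RR_antisymm {t : ℕ} (a b : Fin t → ℕ) (h1 : RR a b) (h2 : RR b a) : a = b := by
  rw [RR_iff] at h1 h2
  have := RL_antisymm _ _ h1 h2
  funext i
  simpa using congrFun this (Fin.rev i)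

theorem RR_trans {t : ℕ} (a b c : Fin t → ℕ) (h1 : RR a b) (h2 : RR b c) : RR a c := by
  rw [RR_iff] at h1 h2 ⊢; exact RL_trans _ _ _ h1 h2

theorem RL_refl {t : ℕ} (a : Fin t → ℕ) : RL a a := fun _ _ => le_rfl
theorem RR_refl {t : ℕ} (a : Fin t → ℕ) : RR a a := fun _ _ => le_rfl

/-- sortedness of adjacent columns -/
def Adj {α : Type*} (r : α → α → Prop) {n : ℕ} (g : Fin n → α) : Prop :=
  ∀ (j : ℕ) (hj : j + 1 < n), r (g ⟨j, by omega⟩) (g ⟨j + 1, hj⟩)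

theorem Adj.le {α : Type*} {r : α → α → Prop} (hr : ∀ a, r a a)
    (ht : ∀ a b c, r a b → r b c → r a c) {n : ℕ} {g : Fin n → α} (h : Adj r g)
    (i j : Fin n) (hij : i ≤ j) : r (g i) (g j) := by
  obtain ⟨j, hj⟩ := j
  obtain ⟨i, hi⟩ := i
  simp only [Fin.mk_le_mk] at hij
  induction j, hij using Nat.le_induction with
  | base => exact hr _
  | succ k hk ih => exact ht _ _ _ (ih (by omega)) (h k hj)

theorem partiteCond_iff (t n : ℕ) (f : Fin t → Fin n → ℕ) :
    PartiteCond t n f ↔ Adj RL (fun j i => f i j) := by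
  constructor
  · intro h j hj i0 hi
    exact h i0 j hj hi
  · intro h i0 j hj hi
    exact h j hj i0 hi

/-- the sorted functions are in bijection with multisets -/
theorem sorted_bij {α : Type*} (r : α → α → Prop) (hr : ∀ a, r a a)
    (htot : ∀ a b, r a b ∨ r b a) (hanti : ∀ a b, r a b → r b a → a = b)
    (ht : ∀ a b c, r a b → r b c → r a c) (n : ℕ) :
    Function.Bijective (fun g : {g : Fin n → α // Adj r g} =>
      (⟨Multiset.ofList (List.ofFn g.1), by simp⟩ : {m : Multiset α // Multiset.card m = n})) := by
  classical
  constructor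
  · rintro ⟨g, hg⟩ ⟨g', hg'⟩ h
    simp only [Subtype.mk.injEq, Multiset.coe_eq_coe] at h
    have s : ∀ g : Fin n → α, Adj r g → (List.ofFn g).Pairwise r := by
      intro g hg
      rw [List.pairwise_ofFn]
      intro i j hij
      exact hg.le hr ht _ _ hij.le
    have := List.Perm.eq_of_pairwise (fun a b _ _ => hanti a b) (s g hg) (s g' hg') h
    simpa using List.ofFn_injective this
  · rintro ⟨m, hm⟩
    have : Std.Total r := ⟨htot⟩
    have : IsTrans α r := ⟨ht⟩
    have : Std.Antisymm r := ⟨hanti⟩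
    have hl : (m.sort r).length = n := by simp [hm]
    subst hl
    refine ⟨⟨(m.sort r).get, ?_⟩, ?_⟩
    · intro j hj
      have := Multiset.pairwise_sort m r
      exact (List.pairwise_iff_get.mp this) ⟨j, by omega⟩ ⟨j+1, hj⟩ (by simp)
    · apply Subtype.ext
      change Multiset.ofList (List.ofFn (m.sort r).get) = m
      rw [List.ofFn_get, Multiset.sort_eq]

theorem card_sorted {t : ℕ} (r : (Fin t → ℕ) → (Fin t → ℕ) → Prop) (hr : ∀ a, r a a)
    (htot : ∀ a b, r a b ∨ r b a) (hanti : ∀ a b, r a b → r b a → a = b)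
    (ht : ∀ a b c, r a b → r b c → r a c) (n : ℕ) (d : Fin t → ℕ) :
    Nat.card {f : Fin t → Fin n → ℕ //
      Adj r (fun j i => f i j) ∧ ∀ i : Fin t, ∑ j : Fin n, f i j = d i} =
    Nat.card {m : Multiset (Fin t → ℕ) // Multiset.card m = n ∧ m.sum = d} := by
  let e := Equiv.ofBijective _ (sorted_bij r hr htot hanti ht n)
  have he : ∀ g, (e g).1 = Multiset.ofList (List.ofFn g.1) := fun g => rfl
  let e1 : {f : Fin t → Fin n → ℕ //
      Adj r (fun j i => f i j) ∧ ∀ i : Fin t, ∑ j : Fin n, f i j = d i} ≃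
      {g : Fin n → Fin t → ℕ // Adj r g ∧ ∑ j, g j = d} :=
    (Equiv.piComm (fun (_ : Fin t) (_ : Fin n) => ℕ)).subtypeEquiv (by
      intro f
      refine and_congr Iff.rfl ?_
      rw [funext_iff]
      simp [Finset.sum_apply])
  refine Nat.card_congr (e1.trans ?_)
  refine (Equiv.subtypeSubtypeEquivSubtypeInter _ _).symm.trans ?_
  refine Equiv.trans ?_ (Equiv.subtypeSubtypeEquivSubtypeInter _ _)
  refine e.subtypeEquiv ?_
  intro g
  rw [he]
  simp [List.sum_ofFn]
theorem sort_unique {n : ℕ} (S : Fin n → Fin n → Prop) (hS : ∀ a b, S a b → S b a → False)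
    (p q : Equiv.Perm (Fin n)) (hp : ∀ i j, i < j → S (p i) (p j))
    (hq : ∀ i j, i < j → S (q i) (q j)) : p = q := by
  have hm : StrictMono (p⁻¹ * q : Equiv.Perm (Fin n)) := by
    intro i j hij
    by_contra hle
    rcases lt_or_eq_of_le (not_lt.mp hle) with h | h
    · have h1 := hp _ _ h
      simp only [Equiv.Perm.mul_apply, Equiv.Perm.coe_inv, Equiv.apply_symm_apply] at h1
      exact hS _ _ h1 (hq _ _ hij)
    · exact hij.ne' ((p⁻¹ * q).injective h)
  have h1 : (p⁻¹ * q : Equiv.Perm (Fin n)) = 1 := by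
    let o : Fin n ≃o Fin n := StrictMono.orderIsoOfSurjective _ hm (Equiv.surjective _)
    have : o = OrderIso.refl _ := Subsingleton.elim _ _
    ext i
    have := congrArg (fun e : Fin n ≃o Fin n => e i) this
    simpa [o] using congrArg Fin.val this
  exact (inv_mul_eq_one.mp h1)

/-- descent indicator -/
def des {n : ℕ} (π : Equiv.Perm (Fin n)) (k : Fin n) : ℕ :=
  if h : k.1 + 1 < n then (if π ⟨k.1 + 1, h⟩ < π k then 1 else 0) else 0

theorem majP_eq {n : ℕ} (π : Equiv.Perm (Fin n)) : majP π = ∑ k : Fin n, (k.1 + 1) * des π k := by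
  unfold majP
  rw [Finset.sum_range]
  refine Finset.sum_congr rfl fun k _ => ?_
  unfold des
  split_ifs <;> simp

/-- the partition with given multiplicities compatible with `π` -/
def lam {n : ℕ} (π : Equiv.Perm (Fin n)) (m : Fin n → ℕ) (k : Fin n) : ℕ :=
  ∑ k' ∈ Finset.Ici k, (m k' + des π k')

theorem lam_succ {n : ℕ} (π : Equiv.Perm (Fin n)) (m : Fin n → ℕ) (k : Fin n) :
    lam π m k = m k + des π k + if h : k.1 + 1 < n then lam π m ⟨k.1 + 1, h⟩ else 0 := by
  unfold lam
  have hI : Finset.Ici k = insert k (Finset.Ioi k) := (Finset.Ioi_insert k).symm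
  rw [hI, Finset.sum_insert (by simp)]
  congr 1
  split_ifs with h
  · refine Finset.sum_congr ?_ fun _ _ => rfl
    ext x
    simp only [Finset.mem_Ioi, Finset.mem_Ici, Fin.lt_def, Fin.le_def]
    omega
  · refine Finset.sum_eq_zero fun x hx => ?_
    simp only [Finset.mem_Ioi, Fin.lt_def] at hx
    omega

theorem lam_sum {n : ℕ} (π : Equiv.Perm (Fin n)) (m : Fin n → ℕ) :
    ∑ k, lam π m k = majP π + ∑ k : Fin n, m k * (k.1 + 1) := by
  unfold lam
  rw [Finset.sum_comm' (t' := Finset.univ) (s' := fun k' => Finset.Iic k') (by simp), majP_eq,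
    ← Finset.sum_add_distrib]
  refine Finset.sum_congr rfl fun k _ => ?_
  simp
  ring

theorem lam_compat_adj {n : ℕ} (π : Equiv.Perm (Fin n)) (m : Fin n → ℕ) :
    Adj (fun a b : ℕ × Fin n => b.1 ≤ a.1 ∧ (a.1 = b.1 → a.2 ≤ b.2))
      (fun k => (lam π m k, π k)) := by
  intro j hj
  have := lam_succ π m ⟨j, by omega⟩
  simp only [hj, dif_pos, des] at this
  dsimp only
  split_ifs at this with h
  · constructor
    · omega
    · omega
  · constructor
    · omega
    · intro _; exact not_lt.mp h

/-- stable order -/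
def St {n : ℕ} (g : Fin n → ℕ) (a b : Fin n) : Prop := g b ≤ g a ∧ (g a = g b → a < b)

theorem St_asymm {n : ℕ} (g : Fin n → ℕ) (a b : Fin n) (h1 : St g a b) (h2 : St g b a) : False := by
  have : g a = g b := le_antisymm h2.1 h1.1
  exact lt_asymm (h1.2 this) (h2.2 this.symm)

/-- one layer -/
def EE {n : ℕ} (x : Equiv.Perm (Fin n) × (Fin n → ℕ)) : Fin n → ℕ := lam x.1 x.2 ∘ ⇑(x.1⁻¹)

theorem EE_compat {n : ℕ} (x : Equiv.Perm (Fin n) × (Fin n → ℕ)) (i j : Fin n) (hij : i < j) :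
    St (EE x) (x.1 i) (x.1 j) := by
  have := (lam_compat_adj x.1 x.2).le (by simp) (by
    rintro ⟨a, a'⟩ ⟨b, b'⟩ ⟨c, c'⟩ ⟨h1, h2⟩ ⟨h3, h4⟩
    dsimp only at *
    refine ⟨by omega, fun h => (h2 (by omega)).trans (h4 (by omega))⟩) i j hij.le
  dsimp only at this
  refine ⟨by simpa [EE] using this.1, fun h => ?_⟩
  refine lt_of_le_of_ne (this.2 (by simpa [EE] using h)) fun h => hij.ne (x.1.injective h)

theorem EE_bij (n : ℕ) : Function.Bijective (EE (n := n)) := by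
  constructor
  · rintro x y h
    have h1 : x.1 = y.1 := sort_unique (St (EE x)) (St_asymm _) _ _ (EE_compat x)
      (by rw [h]; exact EE_compat y)
    obtain ⟨p, m⟩ := x
    obtain ⟨q, m'⟩ := y
    dsimp only at h1
    subst h1
    have hl : ∀ k, lam p m k = lam p m' k := by
      intro k
      simpa [EE] using congrFun h (p k)
    congr 1
    funext k
    have e1 := lam_succ p m k
    have e2 := lam_succ p m' k
    simp only [hl] at e1
    omega
  · intro g
    let σ := Tuple.sort (fun i => OrderDual.toDual (g i))
    have hσ := (Tuple.eq_sort_iff (f := fun i => OrderDual.toDual (g i)) (σ := σ)).mp rfl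
    obtain ⟨hmono, hst⟩ := hσ
    have hmono' : ∀ i j, i ≤ j → g (σ j) ≤ g (σ i) := fun i j hij => hmono hij
    have hst' : ∀ i j, i < j → g (σ i) = g (σ j) → σ i < σ j := fun i j hij h => hst i j hij h
    let m : Fin n → ℕ := fun k => g (σ k) - des σ k - if h : k.1 + 1 < n then g (σ ⟨k.1 + 1, h⟩) else 0
    refine ⟨(σ, m), ?_⟩
    have key : ∀ d : ℕ, ∀ k : Fin n, n - k.1 = d → lam σ m k = g (σ k) := by
      intro d
      induction d with
      | zero => intro k hk; omega
      | succ d ih =>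
        intro k hk
        rw [lam_succ]
        simp only [m]
        by_cases h : k.1 + 1 < n
        · rw [dif_pos h, dif_pos h, ih ⟨k.1 + 1, h⟩ (by simp; omega)]
          have hle : k < ⟨k.1 + 1, h⟩ := by simp [Fin.lt_def]
          have h1 := hmono' _ _ hle.le
          have h2 := hst' _ _ hle
          simp only [des, dif_pos h]
          split_ifs with h3
          · have : g (σ k) ≠ g (σ ⟨k.1 + 1, h⟩) := fun e => lt_asymm h3 (h2 e)
            omega
          · omega
        · simp [dif_neg h, des]
    funext a
    have := key _ (σ⁻¹ a) rfl
    simpa [EE] using this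

theorem EE_sum {n : ℕ} (x : Equiv.Perm (Fin n) × (Fin n → ℕ)) :
    ∑ k, EE x k = majP x.1 + ∑ k : Fin n, x.2 k * (k.1 + 1) := by
  rw [← lam_sum, ← Equiv.sum_comp (x.1⁻¹) (lam x.1 x.2)]
  rfl

/-- all layers -/
def Phi {n : ℕ} : (t : ℕ) → (Fin t → Equiv.Perm (Fin n) × (Fin n → ℕ)) → (Fin t → Fin n → ℕ)
  | 0, _ => Fin.elim0
  | t + 1, x => Fin.cons (EE (x 0)) (fun i => Phi t (Fin.tail x) i ∘ ⇑((x 0).1⁻¹))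

theorem Phi_bij (n t : ℕ) : Function.Bijective (Phi (n := n) t) := by
  induction t with
  | zero => exact ⟨fun _ _ _ => Subsingleton.elim _ _, fun f => ⟨Fin.elim0, Subsingleton.elim _ _⟩⟩
  | succ t ih =>
    constructor
    · intro x y h
      simp only [Phi, Fin.cons_inj] at h
      obtain ⟨h0, h1⟩ := h
      have h0 := (EE_bij n).1 h0
      have h2 : Fin.tail x = Fin.tail y := by
        apply ih.1
        funext i
        have := congrFun h1 i
        rw [h0] at this
        exact (Equiv.surjective _).injective_comp_right this
      rw [← Fin.cons_self_tail x, ← Fin.cons_self_tail y, h0, h2]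
    · intro f
      obtain ⟨x0, h0⟩ := (EE_bij n).2 (f 0)
      obtain ⟨x', h'⟩ := ih.2 (fun i => Fin.tail f i ∘ ⇑(x0.1))
      refine ⟨Fin.cons x0 x', ?_⟩
      simp only [Phi, Fin.cons_zero, Fin.tail_cons, h0, h']
      conv_rhs => rw [← Fin.cons_self_tail f]
      congr 1
      funext i a
      simp

theorem Phi_sum {n : ℕ} (t : ℕ) (x : Fin t → Equiv.Perm (Fin n) × (Fin n → ℕ)) (i : Fin t) :
    ∑ k, Phi t x i k = majP (x i).1 + ∑ k : Fin n, (x i).2 k * (k.1 + 1) := by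
  induction t with
  | zero => exact i.elim0
  | succ t ih =>
    refine Fin.cases ?_ (fun i => ?_) i
    · simp only [Phi, Fin.cons_zero]; exact EE_sum _
    · simp only [Phi, Fin.cons_succ]
      have := ih (Fin.tail x) i
      rw [← Equiv.sum_comp ((x 0).1⁻¹)] at this
      exact this

/-- stable order for tuples -/
def SS {t n : ℕ} (f : Fin t → Fin n → ℕ) (a b : Fin n) : Prop :=
  RR (fun i => f i a) (fun i => f i b) ∧ ((∀ i, f i a = f i b) → a < b)

theorem SS_asymm {t n : ℕ} (f : Fin t → Fin n → ℕ) (a b : Fin n) (h1 : SS f a b) (h2 : SS f b a) :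
    False := by
  have := RR_antisymm _ _ h1.1 h2.1
  have : ∀ i, f i a = f i b := fun i => congrFun this i
  exact lt_asymm (h1.2 this) (h2.2 fun i => (this i).symm)

theorem Phi_compat {n : ℕ} (t : ℕ) (x : Fin t → Equiv.Perm (Fin n) × (Fin n → ℕ)) (i j : Fin n)
    (hij : i < j) :
    SS (Phi t x) ((List.ofFn fun i => (x i).1).prod i) ((List.ofFn fun i => (x i).1).prod j) := by
  induction t with
  | zero => exact ⟨fun i0 => i0.elim0, fun _ => by simpa using hij⟩
  | succ t ih =>
    have h := ih (Fin.tail x)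
    simp only [List.ofFn_succ, List.prod_cons, Equiv.Perm.mul_apply]
    change SS (Phi t (Fin.tail x)) ((List.ofFn fun i : Fin t => (x i.succ).1).prod i)
      ((List.ofFn fun i : Fin t => (x i.succ).1).prod j) at h
    generalize (List.ofFn fun i : Fin t => (x i.succ).1).prod i = a at *
    generalize (List.ofFn fun i : Fin t => (x i.succ).1).prod j = b at *
    obtain ⟨h1, h2⟩ := h
    have hE := EE_compat (x 0) a b
    constructor
    · intro i0
      refine Fin.cases ?_ (fun i0 => ?_) i0
      · intro hi
        simp only [Phi, Fin.cons_zero]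
        refine (hE (h2 fun i => ?_)).1
        have := hi i.succ (Fin.succ_pos i)
        simpa [Phi] using this
      · intro hi
        simp only [Phi, Fin.cons_succ, Function.comp, Equiv.Perm.coe_inv, Equiv.symm_apply_apply]
        refine h1 i0 fun i h => ?_
        have := hi i.succ (Fin.succ_lt_succ_iff.mpr h)
        simpa [Phi] using this
    · intro hi
      refine (hE (h2 fun i => ?_)).2 ?_
      · have := hi i.succ
        simpa [Phi] using this
      · have := hi 0
        simpa [Phi] using this

theorem Phi_sorted_iff {n : ℕ} (t : ℕ) (x : Fin t → Equiv.Perm (Fin n) × (Fin n → ℕ)) :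
    (List.ofFn fun i => (x i).1).prod = 1 ↔ Adj RR (fun j i => Phi t x i j) := by
  have hc := Phi_compat t x
  constructor
  · intro h
    rw [h] at hc
    intro j hj
    exact (hc ⟨j, by omega⟩ ⟨j + 1, hj⟩ (by simp [Fin.lt_def])).1
  · intro h
    refine sort_unique (SS (Phi t x)) (SS_asymm _) _ _ hc fun i j hij => ?_
    exact ⟨h.le RR_refl RR_trans i j hij.le, fun _ => hij⟩
/-- counting series of a weighted set -/
noncomputable def GF {σ A : Type*} (w : A → (σ →₀ ℕ)) : MvPowerSeries σ ℚ :=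
  fun d => (Nat.card {a : A // w a = d} : ℚ)

theorem coeff_GF {σ A : Type*} (w : A → (σ →₀ ℕ)) (d : σ →₀ ℕ) :
    MvPowerSeries.coeff d (GF w) = (Nat.card {a : A // w a = d} : ℚ) := rfl

theorem GF_shift {σ A : Type*} (w : A → (σ →₀ ℕ)) (e : σ →₀ ℕ) :
    GF (fun a => e + w a) = MvPowerSeries.monomial e 1 * GF w := by
  classical
  ext d
  rw [MvPowerSeries.coeff_monomial_mul, coeff_GF]
  split_ifs with h
  · rw [coeff_GF, one_mul]
    congr 1
    refine Nat.card_congr (Equiv.subtypeEquivRight fun a => ?_)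
    constructor
    · intro h'; rw [← h']; simp
    · intro h'; rw [h']; exact add_tsub_cancel_of_le h
  · have : IsEmpty {a : A // e + w a = d} := ⟨fun a => h (by rw [← a.2]; exact le_self_add)⟩
    simp

theorem GF_equiv {σ A B : Type*} (e : A ≃ B) (w : B → (σ →₀ ℕ)) :
    GF (fun a => w (e a)) = GF w := by
  ext d
  rw [coeff_GF, coeff_GF]
  congr 1
  exact Nat.card_congr (e.subtypeEquiv fun a => Iff.rfl)

theorem fin_fiber {σ ι : Type*} [Fintype ι] (e : ι → (σ →₀ ℕ)) (he : ∀ x, e x ≠ 0)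
    (d : σ →₀ ℕ) : Finite {m : ι → ℕ // ∑ x, m x • e x = d} := by
  classical
  have : {m : ι → ℕ | ∑ x, m x • e x = d} ⊆ Set.Iic (fun _ => d.degree) := by
    intro m hm x
    have hm : ∑ x, m x • e x = d := hm
    rw [← hm]
    simp only [map_sum, map_nsmul, smul_eq_mul]
    have h1 : m x * (e x).degree ≤ ∑ x, m x * (e x).degree :=
      Finset.single_le_sum (f := fun x => m x * (e x).degree) (fun _ _ => Nat.zero_le _) (Finset.mem_univ x)
    have h2 : (e x).degree ≠ 0 := by
      rw [Ne, Finsupp.degree_eq_zero_iff]; exact he x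
    exact (Nat.le_mul_of_pos_right _ (Nat.pos_of_ne_zero h2)).trans h1
  exact ((Set.finite_Iic _).subset this).to_subtype

theorem GF_fin {σ : Type*} (k : ℕ) (e : Fin k → (σ →₀ ℕ)) (he : ∀ x, e x ≠ 0) :
    GF (fun m : Fin k → ℕ => ∑ x, m x • e x) *
      ∏ x, (1 - MvPowerSeries.monomial (e x) (1 : ℚ)) = 1 := by
  classical
  induction k with
  | zero =>
    simp only [Finset.univ_eq_empty, Finset.sum_empty, Finset.prod_empty, mul_one]
    ext d
    rw [coeff_GF, MvPowerSeries.coeff_one]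
    split_ifs with h
    · subst h; simp
    · have : IsEmpty {a : Fin 0 → ℕ // (0 : σ →₀ ℕ) = d} := ⟨fun a => h a.2.symm⟩
      simp
  | succ k ih =>
    rw [Fin.prod_univ_succ, ← mul_assoc]
    have key : GF (fun m : Fin (k + 1) → ℕ => ∑ x, m x • e x) =
        GF (fun m : Fin k → ℕ => ∑ x, m x • e x.succ) +
        GF (fun m : Fin (k + 1) → ℕ => e 0 + ∑ x, m x • e x) := by
      ext d
      rw [map_add, coeff_GF, coeff_GF, coeff_GF, ← Nat.cast_add]
      congr 1
      have := fin_fiber e he d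
      have := fin_fiber (fun x => e (Fin.succ x)) (fun x => he _) d
      have : Finite {m : Fin (k + 1) → ℕ // e 0 + ∑ x, m x • e x = d} := by
        refine Finite.of_injective (β := {m : Fin (k + 1) → ℕ // ∑ x, m x • e x = d})
          (fun m => ⟨Fin.cons (m.1 0 + 1) (Fin.tail m.1), ?_⟩) ?_
        · refine Eq.trans ?_ m.2
          rw [Fin.sum_univ_succ, Fin.sum_univ_succ]
          simp [Fin.tail, add_smul]
          abel
        · intro m m' h
          simp only [Subtype.mk.injEq, Fin.cons_inj, add_left_inj] at h
          ext1
          rw [← Fin.cons_self_tail m.1, ← Fin.cons_self_tail m'.1, h.1, h.2]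
      rw [← Nat.card_sum]
      symm
      refine Nat.card_congr (Equiv.ofBijective (Sum.elim
        (fun m => ⟨Fin.cons 0 m.1, ?_⟩)
        (fun m => ⟨Fin.cons (m.1 0 + 1) (Fin.tail m.1), ?_⟩)) ⟨?_, ?_⟩)
      · refine Eq.trans ?_ m.2
        rw [Fin.sum_univ_succ]; simp
      · refine Eq.trans ?_ m.2
        rw [Fin.sum_univ_succ, Fin.sum_univ_succ]
        simp [Fin.tail, add_smul]
        abel
      · rintro (m | m) (m' | m') h
        · simp only [Sum.elim_inl, Subtype.mk.injEq, Fin.cons_inj, true_and] at h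
          rw [Subtype.ext h]
        · simp [Fin.cons_inj] at h
        · simp [Fin.cons_inj] at h
        · simp only [Sum.elim_inr, Subtype.mk.injEq, Fin.cons_inj, add_left_inj] at h
          congr 1
          ext1
          rw [← Fin.cons_self_tail m.1, ← Fin.cons_self_tail m'.1, h.1, h.2]
      · rintro ⟨m, hm⟩
        rcases h0 : m 0 with _ | c
        · refine ⟨Sum.inl ⟨Fin.tail m, ?_⟩, ?_⟩
          · rw [← hm, Fin.sum_univ_succ, h0]; simp [Fin.tail]
          · simp only [Sum.elim_inl, Subtype.mk.injEq]
            rw [← h0, Fin.cons_self_tail]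
        · refine ⟨Sum.inr ⟨Fin.cons c (Fin.tail m), ?_⟩, ?_⟩
          · rw [← hm, Fin.sum_univ_succ, Fin.sum_univ_succ, h0]
            simp [Fin.tail, add_smul]
            abel
          · simp only [Sum.elim_inr, Subtype.mk.injEq, Fin.cons_zero, Fin.tail_cons]
            rw [← h0, Fin.cons_self_tail]
    have key2 : GF (fun m : Fin (k + 1) → ℕ => ∑ x, m x • e x) *
        (1 - MvPowerSeries.monomial (e 0) (1 : ℚ)) =
        GF (fun m : Fin k → ℕ => ∑ x, m x • e x.succ) := by
      rw [GF_shift] at key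
      linear_combination key
    rw [key2]
    exact ih (fun x => e x.succ) fun x => he _

theorem GF_fintype {σ ι : Type*} [Fintype ι] (e : ι → (σ →₀ ℕ)) (he : ∀ x, e x ≠ 0) :
    GF (fun m : ι → ℕ => ∑ x, m x • e x) *
      ∏ x, (1 - MvPowerSeries.monomial (e x) (1 : ℚ)) = 1 := by
  have E := (Fintype.equivFin ι).symm
  have h := GF_fin _ (fun x => e (E x)) fun x => he _
  rw [Equiv.prod_comp E (fun x => 1 - MvPowerSeries.monomial (e x) (1 : ℚ))] at h
  refine Eq.trans ?_ h
  congr 1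
  rw [← GF_equiv (E.arrowCongr (Equiv.refl ℕ)).symm]
  congr 1
  funext m
  rw [← Equiv.sum_comp E]
  simp

theorem partiteSeries_eq (t n : ℕ) : partiteSeries t n =
    GF (fun x : {x : Fin t → Equiv.Perm (Fin n) × (Fin n → ℕ) //
      (List.ofFn fun i => (x i).1).prod = 1} =>
      (Finsupp.equivFunOnFinite.symm fun i => majP (x.1 i).1) +
      ∑ p : Fin t × Fin n, (x.1 p.1).2 p.2 • Finsupp.single p.1 (p.2.1 + 1)) := by
  classical
  ext d
  rw [coeff_GF]
  change ((Nat.card {f : Fin t → Fin n → ℕ //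
    PartiteCond t n f ∧ ∀ i : Fin t, ∑ j : Fin n, f i j = d i} : ℕ) : ℚ) = _
  congr 1
  simp only [partiteCond_iff]
  rw [card_sorted RL RL_refl RL_total RL_antisymm RL_trans,
    ← card_sorted RR RR_refl RR_total RR_antisymm RR_trans]
  symm
  refine Nat.card_congr ((Equiv.subtypeSubtypeEquivSubtypeInter _
    (fun x : Fin t → Equiv.Perm (Fin n) × (Fin n → ℕ) =>
      (Finsupp.equivFunOnFinite.symm fun i => majP (x i).1) +
      ∑ p : Fin t × Fin n, (x p.1).2 p.2 • Finsupp.single p.1 (p.2.1 + 1) = d)).trans ?_)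
  refine (Equiv.ofBijective _ (Phi_bij n t)).subtypeEquiv fun x => ?_
  refine and_congr (Phi_sorted_iff t x) ?_
  rw [Finsupp.ext_iff]
  refine forall_congr' fun i => ?_
  simp only [Equiv.ofBijective_apply, Phi_sum]
  have hs : (∑ p : Fin t × Fin n, (x p.1).2 p.2 • Finsupp.single p.1 (p.2.1 + 1) : Fin t →₀ ℕ) i
      = ∑ k : Fin n, (x i).2 k * (k.1 + 1) := by
    rw [Fintype.sum_prod_type, Finset.sum_comm, Finsupp.finsetSum_apply]
    refine Finset.sum_congr rfl fun k _ => ?_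
    rw [Finsupp.finsetSum_apply, Finset.sum_eq_single i]
    · rw [Finsupp.smul_apply, Finsupp.single_eq_same, smul_eq_mul]
    · intro b _ hb
      rw [Finsupp.smul_apply, Finsupp.single_eq_of_ne hb.symm, smul_zero]
    · simp
  rw [Finsupp.add_apply, hs]
  rfl

open scoped Classical in
theorem GF_decomp (t n : ℕ) : partiteSeries t n =
    ∑ π ∈ Finset.univ.filter
          (fun π : Fin t → Equiv.Perm (Fin n) => (List.ofFn π).prod = 1),
      GF (fun m : Fin t × Fin n → ℕ => (Finsupp.equivFunOnFinite.symm fun i => majP (π i)) +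
      ∑ p : Fin t × Fin n, m p • Finsupp.single p.1 (p.2.1 + 1)) := by
  rw [partiteSeries_eq]
  ext d
  rw [coeff_GF, map_sum]
  simp only [coeff_GF]
  rw [← Nat.cast_sum]
  congr 1
  rw [← Finset.sum_coe_sort]
  have : ∀ π : Fin t → Equiv.Perm (Fin n), Finite {m : Fin t × Fin n → ℕ //
      (Finsupp.equivFunOnFinite.symm fun i => majP (π i)) +
      ∑ p : Fin t × Fin n, m p • Finsupp.single p.1 (p.2.1 + 1) = d} := by
    intro π
    have := fin_fiber (fun p : Fin t × Fin n => Finsupp.single p.1 (p.2.1 + 1)) (by simp)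
      (d - Finsupp.equivFunOnFinite.symm fun i => majP (π i))
    refine Finite.of_injective (β := {m : Fin t × Fin n → ℕ //
      ∑ p : Fin t × Fin n, m p • Finsupp.single p.1 (p.2.1 + 1) = d -
        Finsupp.equivFunOnFinite.symm fun i => majP (π i)}) (fun m => ⟨m.1, ?_⟩) ?_
    · refine Eq.trans ?_ (congrArg (fun z => z - _) m.2)
      simp
    · intro m m' h
      exact Subtype.ext (by simpa using h)
  rw [← Nat.card_sigma]
  refine Nat.card_congr ?_
  exact {
    toFun := fun x => ⟨⟨fun i => (x.1.1 i).1, by simpa using x.1.2⟩,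
      ⟨fun p => (x.1.1 p.1).2 p.2, x.2⟩⟩
    invFun := fun y => ⟨⟨fun i => (y.1.1 i, fun j => y.2.1 (i, j)),
      (Finset.mem_filter.mp y.1.2).2⟩, y.2.2⟩
    left_inv := fun x => rfl
    right_inv := fun y => rfl }

open scoped Classical in
/-- Garsia–Gessel: the generating function of `t`-partite partitions
with `n` parts equals
`[Σ_{π_1 ⋯ π_t = 1} Π_i q_i^{maj(π_i)}] / [Π_{i=1}^t Π_{j=1}^n (1 - q_i^j)]`. -/
theorem garsia_gessel_partite (t n : ℕ) :
    partiteSeries t n *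
        ∏ i : Fin t, ∏ j ∈ Finset.range n,
          (1 - (MvPowerSeries.X i : MvPowerSeries (Fin t) ℚ) ^ (j + 1)) =
      ∑ π ∈ Finset.univ.filter
          (fun π : Fin t → Equiv.Perm (Fin n) => (List.ofFn π).prod = 1),
        ∏ i : Fin t, (MvPowerSeries.X i : MvPowerSeries (Fin t) ℚ) ^ majP (π i) := by
  have h := GF_fintype (fun p : Fin t × Fin n => Finsupp.single p.1 (p.2.1 + 1)) (by simp)
  have hp : ∏ p : Fin t × Fin n, (1 - MvPowerSeries.monomial
      (Finsupp.single p.1 (p.2.1 + 1)) (1 : ℚ)) =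
      ∏ i : Fin t, ∏ j ∈ Finset.range n,
          (1 - (MvPowerSeries.X i : MvPowerSeries (Fin t) ℚ) ^ (j + 1)) := by
    rw [Fintype.prod_prod_type]
    refine Finset.prod_congr rfl fun i _ => ?_
    rw [Finset.prod_range]
    simp [MvPowerSeries.X_pow_eq]
  rw [hp] at h
  rw [GF_decomp, Finset.sum_mul]
  refine Finset.sum_congr rfl fun π _ => ?_
  rw [GF_shift, mul_assoc, h, mul_one]
  simp only [MvPowerSeries.X_pow_eq]
  rw [MvPowerSeries.prod_monomial]
  congr 1
  · congr 1
    ext i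
    simp [Finsupp.single_apply]
  · simp
end
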